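/- arXiv:math/0604061 — 4 statements merged into one kernel-verified Lean document; each statement's English description precedes it below -/
import Mathlib

section
/- Let G be a Garside group with Garside element Δ and N = ‖Δ‖. For every element g of G, the fractional part of t_inf(g) does not lie in the open interval (0, 1/N); that is, frac(t_inf(g)) = 0 or frac(t_inf(g)) ≥ 1/N. -/
open Filter Topology Pointwise

/-- Left divisibility order on a group relative to a submonoid `P` of positive elements:
`a ≤_L b` iff `a⁻¹ * b ∈ P`. -/
def leL {G : Type*} [Group G] (P : Submonoid G) (a b : G) : Prop := a⁻¹ * b ∈ P

/-- Right divisibility order: `a ≤_R b` iff `b * a⁻¹ ∈ P`. -/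
def leR {G : Type*} [Group G] (P : Submonoid G) (a b : G) : Prop := b * a⁻¹ ∈ P

/-- An atom of the positive monoid `P`: a nontrivial element admitting no nontrivial
factorization inside `P`. -/
def IsMonAtom {G : Type*} [Group G] (P : Submonoid G) (a : G) : Prop :=
  a ∈ P ∧ a ≠ 1 ∧ ∀ b c : G, b ∈ P → c ∈ P → a = b * c → b = 1 ∨ c = 1

/-- `a` can be written as a product of `n` atoms of `P`. -/
def IsAtomProd {G : Type*} [Group G] (P : Submonoid G) (n : ℕ) (a : G) : Prop :=
  ∃ l : List G, l.length = n ∧ (∀ x ∈ l, IsMonAtom P x) ∧ l.prod = a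

/-- A Garside structure on a group `G`: `G` is the group of fractions of the positive
monoid `P`, which is a finitely generated atomic monoid (with atomic norm `norm`),
a lattice for both `≤_L` and `≤_R`, equipped with a Garside element `Δ` whose left and
right divisors coincide and generate `P`.  The fields `zinf`, `zsup`, `infs`, `sups`,
`tinf`, `tsup` are the (uniquely determined) invariants
`inf g = max {r : Δ^r ≤_L g}`, `sup g = min {s : g ≤_L Δ^s}`,
`inf_s g = max {inf h : h ∈ [g]}`, `sup_s g = min {sup h : h ∈ [g]}`,
`t_inf g = lim inf(gⁿ)/n` and `t_sup g = lim sup(gⁿ)/n`,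
each given together with its defining specification. -/
structure GarsideGroup (G : Type*) [Group G] where
  P : Submonoid G
  /-- `G` is the group of fractions of `P`. -/
  fraction : ∀ g : G, ∃ a b : G, a ∈ P ∧ b ∈ P ∧ g = a⁻¹ * b
  /-- `P` is finitely generated. -/
  fg : P.FG
  /-- the atomic norm `‖·‖` -/
  norm : G → ℕ
  /-- `P` is atomic: every positive element is a product of atoms and `norm a` is the
  greatest length of such an expression. -/
  norm_spec : ∀ a ∈ P, IsGreatest {n : ℕ | IsAtomProd P n a} (norm a)
  /-- `(P, ≤_L)` is a lattice: gcd's and lcm's exist. -/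
  latticeL : ∀ a ∈ P, ∀ b ∈ P,
    (∃ c ∈ P, leL P c a ∧ leL P c b ∧ ∀ d ∈ P, leL P d a → leL P d b → leL P d c) ∧
    (∃ c ∈ P, leL P a c ∧ leL P b c ∧ ∀ d ∈ P, leL P a d → leL P b d → leL P c d)
  /-- `(P, ≤_R)` is a lattice. -/
  latticeR : ∀ a ∈ P, ∀ b ∈ P,
    (∃ c ∈ P, leR P c a ∧ leR P c b ∧ ∀ d ∈ P, leR P d a → leR P d b → leR P d c) ∧
    (∃ c ∈ P, leR P a c ∧ leR P b c ∧ ∀ d ∈ P, leR P a d → leR P b d → leR P c d)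
  /-- the Garside element -/
  Δ : G
  Δ_mem : Δ ∈ P
  /-- the left and right divisors of `Δ` coincide -/
  Δ_balanced : ∀ a ∈ P, (leL P a Δ ↔ leR P a Δ)
  /-- the simple elements generate `P` -/
  simples_gen : Submonoid.closure {a : G | a ∈ P ∧ leL P a Δ} = P
  /-- `inf g = max {r : ℤ | Δ^r ≤_L g}` -/
  zinf : G → ℤ
  /-- `sup g = min {s : ℤ | g ≤_L Δ^s}` -/
  zsup : G → ℤ
  zinf_spec : ∀ g : G, IsGreatest {r : ℤ | leL P (Δ ^ r) g} (zinf g)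
  zsup_spec : ∀ g : G, IsLeast {s : ℤ | leL P g (Δ ^ s)} (zsup g)
  /-- `inf_s g = max {inf h : h ∈ [g]}` -/
  infs : G → ℤ
  /-- `sup_s g = min {sup h : h ∈ [g]}` -/
  sups : G → ℤ
  infs_spec : ∀ g : G, IsGreatest (Set.range fun h : G => zinf (h⁻¹ * g * h)) (infs g)
  sups_spec : ∀ g : G, IsLeast (Set.range fun h : G => zsup (h⁻¹ * g * h)) (sups g)
  /-- `t_inf g = lim_{n → ∞} inf(gⁿ)/n` -/
  tinf : G → ℝ
  /-- `t_sup g = lim_{n → ∞} sup(gⁿ)/n` -/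
  tsup : G → ℝ
  tinf_spec : ∀ g : G,
    Filter.Tendsto (fun n : ℕ => (zinf (g ^ n) : ℝ) / (n : ℝ)) Filter.atTop (nhds (tinf g))
  tsup_spec : ∀ g : G,
    Filter.Tendsto (fun n : ℕ => (zsup (g ^ n) : ℝ) / (n : ℝ)) Filter.atTop (nhds (tsup g))

namespace GarsideGroup

variable {G : Type*} [Group G] (Γ : GarsideGroup G)

/-- The set `𝒟` of simple elements. -/
def simples : Set G := {a : G | a ∈ Γ.P ∧ leL Γ.P a Γ.Δ}

/-- `len g = sup g - inf g` -/
def len (g : G) : ℤ := Γ.zsup g - Γ.zinf g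

/-- `t_len g = t_sup g - t_inf g` -/
noncomputable def tlen (g : G) : ℝ := Γ.tsup g - Γ.tinf g

/-- `g` is inf-straight if `inf g = t_inf g`. -/
def InfStraight (g : G) : Prop := (Γ.zinf g : ℝ) = Γ.tinf g

/-- `g` is sup-straight if `sup g = t_sup g`. -/
def SupStraight (g : G) : Prop := (Γ.zsup g : ℝ) = Γ.tsup g

/-- The super summit set `[g]^S`. -/
def superSummit (g : G) : Set G :=
  {h : G | (∃ x : G, x⁻¹ * g * x = h) ∧ Γ.zinf h = Γ.infs g ∧ Γ.zsup h = Γ.sups g}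

end GarsideGroup

/-- The shortest length of a word over the alphabet `X` representing `g`. -/
noncomputable def wlen {G : Type*} [Group G] (X : Set G) (g : G) : ℕ :=
  sInf {n : ℕ | ∃ l : List G, l.length = n ∧ (∀ x ∈ l, x ∈ X) ∧ l.prod = g}

/-- The purely order-theoretic core. -/
lemma core_chain {L : Type*} [Lattice L] (f R : L ≃o L) (comm : ∀ x, f (R x) = R (f x))
    (z : L) (hz : z ≤ f z) (hzR : z ≤ R z) (n : ℕ) (hn : R z ≤ f^[n] z)
    (N : ℕ) (d : L → ℕ) (hd : ∀ a b, z ≤ a → a < b → b ≤ R z → d a + 1 ≤ d b)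
    (hdN : d (R z) ≤ N) : R z ≤ f^[N] z := by
  have mono : ∀ i, f^[i] z ≤ f^[i+1] z := by
    intro i
    induction i with
    | zero => simpa using hz
    | succ i ih =>
      rw [Function.iterate_succ_apply', Function.iterate_succ_apply' _ (i+1)]
      exact f.monotone ih
  have monoM : Monotone (fun i => f^[i] z) := monotone_nat_of_le_succ mono
  have stall : ∀ i, f^[i] z ⊓ R z = f^[i+1] z ⊓ R z →
      f^[i+1] z ⊓ R z = f^[i+2] z ⊓ R z := by
    intro i h
    have h1 := congrArg f h
    rw [f.map_inf, f.map_inf, comm] at h1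
    rw [← Function.iterate_succ_apply' f, ← Function.iterate_succ_apply' f] at h1
    have h2 : R z ≤ R (f z) := R.monotone hz
    have h3 := congrArg (· ⊓ R z) h1
    simp only [inf_assoc, inf_eq_right.2 h2] at h3
    exact h3
  have stall2 : ∀ i, f^[i] z ⊓ R z = f^[i+1] z ⊓ R z →
      ∀ j, f^[i+j] z ⊓ R z = f^[i] z ⊓ R z ∧ f^[i+j] z ⊓ R z = f^[i+j+1] z ⊓ R z := by
    intro i h j
    induction j with
    | zero => exact ⟨rfl, h⟩
    | succ j ih => exact ⟨ih.2.symm.trans ih.1, stall _ ih.2⟩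
  have z_le : ∀ i, z ≤ f^[i] z ⊓ R z := fun i => le_inf (monoM (Nat.zero_le i)) hzR
  have key : ∀ i, R z ≤ f^[i] z ∨ i ≤ d (f^[i] z ⊓ R z) := by
    intro i
    induction i with
    | zero => right; exact Nat.zero_le _
    | succ i ih =>
      rcases ih with ih | ih
      · left; exact ih.trans (mono i)
      · by_cases h : f^[i] z ⊓ R z = f^[i+1] z ⊓ R z
        · left
          have h1 := (stall2 i h n).1
          have h2 : R z ≤ f^[i+n] z := hn.trans (monoM (Nat.le_add_left n i))
          rw [inf_eq_right.2 h2] at h1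
          have h3 : R z ≤ f^[i] z := inf_eq_right.1 h1.symm
          exact h3.trans (mono i)
        · right
          have := hd _ _ (z_le i) (lt_of_le_of_ne (inf_le_inf_right _ (mono i)) h) inf_le_right
          omega
  by_contra hc
  rcases key N with h | h
  · exact hc h
  · have hlt : f^[N] z ⊓ R z < R z := lt_of_le_of_ne inf_le_right (fun e => hc (inf_eq_right.1 e))
    have := hd _ _ (z_le N) hlt le_rfl
    omega

/-- Joining the first iterates. -/
lemma core_join {L : Type*} [Lattice L] (f R : L ≃o L) (comm : ∀ x, f (R x) = R (f x))
    (hR : ∀ x, x ≤ R x) (x : L) (n : ℕ) (hn : R x ≤ f^[n+1] x) :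
    ∃ z, z ≤ f z ∧ R z ≤ f^[n+1] z := by
  have itcomm : ∀ i y, f^[i] (R y) = R (f^[i] y) := by
    intro i
    induction i with
    | zero => intro y; rfl
    | succ i ih => intro y; rw [Function.iterate_succ_apply, comm, ih, ← Function.iterate_succ_apply]
  have itmono : ∀ i, Monotone f^[i] := fun i => f.monotone.iterate i
  refine ⟨(Finset.range (n+1)).sup' Finset.nonempty_range_add_one (fun i => f^[i] x), ?_, ?_⟩
  · refine Finset.sup'_le _ _ ?_
    intro i hi
    rcases i with _ | i
    · refine (hR x).trans (hn.trans ?_)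
      rw [Function.iterate_succ_apply']
      exact f.monotone (Finset.le_sup' (fun i => f^[i] x) (by simp : n ∈ Finset.range (n+1)))
    · rw [Function.iterate_succ_apply']
      refine f.monotone (Finset.le_sup' (fun i => f^[i] x) ?_)
      simp at hi ⊢; omega
  · rw [map_finset_sup' R Finset.nonempty_range_add_one]
    refine Finset.sup'_le _ _ ?_
    intro i hi
    simp only [Function.comp]
    rw [← itcomm]
    refine (itmono i hn).trans ?_
    rw [← Function.iterate_add_apply, add_comm, Function.iterate_add_apply]
    exact itmono _ (Finset.le_sup' (fun i => f^[i] x) hi)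

namespace GarsideGroup

variable {G : Type*} [Group G] (Γ : GarsideGroup G)

lemma conj_one (p : G) (hp : p ∈ Γ.P) :
    Γ.Δ * p * Γ.Δ⁻¹ ∈ Γ.P ∧ Γ.Δ⁻¹ * p * Γ.Δ ∈ Γ.P := by
  rw [← Γ.simples_gen] at hp
  induction hp using Submonoid.closure_induction with
  | mem a ha =>
    obtain ⟨haP, haL⟩ := ha
    constructor
    · have haR := (Γ.Δ_balanced a haP).1 haL
      have hc : Γ.Δ * a⁻¹ ∈ Γ.P := haR
      have h1 : leL Γ.P (Γ.Δ * a⁻¹) Γ.Δ := by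
        unfold leL; simpa using haP
      have h2 := (Γ.Δ_balanced _ hc).1 h1
      unfold leR at h2
      simpa [mul_assoc] using h2
    · have hb : a⁻¹ * Γ.Δ ∈ Γ.P := haL
      have h1 : leR Γ.P (a⁻¹ * Γ.Δ) Γ.Δ := by
        unfold leR; simpa using haP
      have h2 := (Γ.Δ_balanced _ hb).2 h1
      unfold leL at h2
      simpa [mul_assoc] using h2
  | one => simp [Γ.P.one_mem]
  | mul a b _ _ ha hb =>
    constructor
    · have := Γ.P.mul_mem ha.1 hb.1
      simpa [mul_assoc] using this
    · have := Γ.P.mul_mem ha.2 hb.2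
      simpa [mul_assoc] using this

lemma conj_zpow (k : ℤ) : ∀ p ∈ Γ.P, Γ.Δ ^ k * p * (Γ.Δ ^ k)⁻¹ ∈ Γ.P := by
  induction k using Int.induction_on with
  | zero => intro p hp; simpa using hp
  | succ i ih =>
    intro p hp
    have := (Γ.conj_one _ (ih p hp)).1
    rw [add_comm, zpow_add, zpow_one]
    simpa [mul_assoc] using this
  | pred i ih =>
    intro p hp
    have := (Γ.conj_one _ (ih p hp)).2
    rw [sub_eq_add_neg, add_comm, zpow_add, zpow_neg_one]
    simpa [mul_assoc] using this

lemma norm_mul (a b : G) (ha : a ∈ Γ.P) (hb : b ∈ Γ.P) :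
    Γ.norm a + Γ.norm b ≤ Γ.norm (a * b) := by
  obtain ⟨l, hl, hl', hl''⟩ := (Γ.norm_spec a ha).1
  obtain ⟨k, hk, hk', hk''⟩ := (Γ.norm_spec b hb).1
  refine (Γ.norm_spec _ (Γ.P.mul_mem ha hb)).2 ⟨l ++ k, by simp [hl, hk], ?_, by simp [hl'', hk'']⟩
  intro x hx
  rcases List.mem_append.1 hx with h | h
  · exact hl' x h
  · exact hk' x h

lemma norm_pos (a : G) (ha : a ∈ Γ.P) (h1 : a ≠ 1) : 1 ≤ Γ.norm a := by
  obtain ⟨l, hl, hl', hl''⟩ := (Γ.norm_spec a ha).1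
  by_contra hc
  have : l = [] := List.length_eq_zero_iff.1 (by omega)
  subst this
  exact h1 (by simpa using hl''.symm)

lemma eq_one_of_inv (a : G) (ha : a ∈ Γ.P) (hb : a⁻¹ ∈ Γ.P) : a = 1 := by
  by_contra h
  have h1 := Γ.norm_pos a ha h
  have h2 := Γ.norm_mul a a⁻¹ ha hb
  have h3 := Γ.norm_mul (a * a⁻¹) a (by simp [Γ.P.one_mem]) ha
  simp only [mul_inv_cancel, one_mul] at h2 h3
  omega

lemma leL_trans {a b c : G} (h : leL Γ.P a b) (h' : leL Γ.P b c) : leL Γ.P a c := by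
  unfold leL at *
  have := Γ.P.mul_mem h h'
  simpa [mul_assoc] using this

lemma leL_mul (g : G) {a b : G} : leL Γ.P (g * a) (g * b) ↔ leL Γ.P a b := by
  unfold leL; simp [mul_assoc]

lemma leL_mul_zpow (k : ℤ) {a b : G} (h : leL Γ.P a b) :
    leL Γ.P (a * Γ.Δ ^ k) (b * Γ.Δ ^ k) := by
  unfold leL at *
  have := Γ.conj_zpow (-k) _ h
  simpa [mul_assoc] using this

lemma leL_zpow {k l : ℤ} (h : k ≤ l) : leL Γ.P (Γ.Δ ^ k) (Γ.Δ ^ l) := by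
  unfold leL
  rw [← zpow_neg, ← zpow_add]
  obtain ⟨n, hn⟩ := Int.eq_ofNat_of_zero_le (show 0 ≤ -k + l by omega)
  rw [hn, zpow_natCast]
  exact Γ.P.pow_mem Γ.Δ_mem n

lemma zinf_le (g : G) : leL Γ.P (Γ.Δ ^ (Γ.zinf g)) g := (Γ.zinf_spec g).1

lemma common_lower (x y : G) : ∃ t, leL Γ.P t x ∧ leL Γ.P t y :=
  ⟨Γ.Δ ^ (min (Γ.zinf x) (Γ.zinf y)),
    Γ.leL_trans (Γ.leL_zpow (min_le_left _ _)) (Γ.zinf_le x),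
    Γ.leL_trans (Γ.leL_zpow (min_le_right _ _)) (Γ.zinf_le y)⟩

lemma exists_sup (x y : G) : ∃ c, leL Γ.P x c ∧ leL Γ.P y c ∧
    ∀ d, leL Γ.P x d → leL Γ.P y d → leL Γ.P c d := by
  obtain ⟨t, hx, hy⟩ := Γ.common_lower x y
  obtain ⟨c, hc, h1, h2, h3⟩ := (Γ.latticeL _ hx _ hy).2
  refine ⟨t * c, ?_, ?_, ?_⟩
  · rw [← Γ.leL_mul t⁻¹]; simpa using h1
  · rw [← Γ.leL_mul t⁻¹]; simpa using h2
  · intro d hd hd'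
    rw [← Γ.leL_mul t⁻¹]
    have := h3 (t⁻¹ * d) (Γ.leL_trans hx hd) ((Γ.leL_mul _).2 hd) ((Γ.leL_mul _).2 hd')
    simpa using this

lemma exists_inf (x y : G) : ∃ c, leL Γ.P c x ∧ leL Γ.P c y ∧
    ∀ d, leL Γ.P d x → leL Γ.P d y → leL Γ.P d c := by
  obtain ⟨t, hx, hy⟩ := Γ.common_lower x y
  obtain ⟨c, hc, h1, h2, h3⟩ := (Γ.latticeL _ hx _ hy).1
  refine ⟨t * c, ?_, ?_, ?_⟩
  · rw [← Γ.leL_mul t⁻¹]; simpa using h1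
  · rw [← Γ.leL_mul t⁻¹]; simpa using h2
  · intro d hd hd'
    obtain ⟨e, he1, he2, he3⟩ := Γ.exists_sup d t
    refine Γ.leL_trans he1 ?_
    rw [← Γ.leL_mul t⁻¹]
    have := h3 (t⁻¹ * e) he2 ((Γ.leL_mul _).2 (he3 _ hd hx)) ((Γ.leL_mul _).2 (he3 _ hd' hy))
    simpa using this

/-- The lattice structure on `G` given by `≤_L`. -/
noncomputable def lat : Lattice G where
  le := leL Γ.P
  le_refl a := by simp [leL, Γ.P.one_mem]
  le_trans _ _ _ h h' := Γ.leL_trans h h'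
  le_antisymm a b h h' := by
    have := Γ.eq_one_of_inv (a⁻¹ * b) h (by simpa [leL] using h')
    exact (inv_mul_eq_one.1 this)
  sup x y := (Γ.exists_sup x y).choose
  le_sup_left x y := (Γ.exists_sup x y).choose_spec.1
  le_sup_right x y := (Γ.exists_sup x y).choose_spec.2.1
  sup_le x y d h h' := (Γ.exists_sup x y).choose_spec.2.2 d h h'
  inf x y := (Γ.exists_inf x y).choose
  inf_le_left x y := (Γ.exists_inf x y).choose_spec.1
  inf_le_right x y := (Γ.exists_inf x y).choose_spec.2.1
  le_inf d x y h h' := (Γ.exists_inf x y).choose_spec.2.2 d h h'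

/-- The map `x ↦ g x Δ^k` as an order automorphism. -/
noncomputable def auto (g : G) (k : ℤ) : letI := Γ.lat; G ≃o G :=
  letI := Γ.lat
  { toFun := fun x => g * x * Γ.Δ ^ k
    invFun := fun x => g⁻¹ * x * (Γ.Δ ^ k)⁻¹
    left_inv := fun x => by simp [mul_assoc]
    right_inv := fun x => by simp [mul_assoc]
    map_rel_iff' := by
      intro a b
      change leL Γ.P (g * a * Γ.Δ ^ k) (g * b * Γ.Δ ^ k) ↔ leL Γ.P a b
      constructor
      · intro h
        have := Γ.leL_mul_zpow (-k) h
        rw [mul_assoc, ← zpow_add, mul_assoc (g * b), ← zpow_add] at this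
        simpa [Γ.leL_mul] using this
      · intro h
        rw [mul_assoc, mul_assoc, Γ.leL_mul]
        exact Γ.leL_mul_zpow k h }

lemma auto_apply (g : G) (k : ℤ) (x : G) : letI := Γ.lat; Γ.auto g k x = g * x * Γ.Δ ^ k := rfl

lemma auto_iterate (g : G) (k : ℤ) (n : ℕ) (x : G) :
    letI := Γ.lat; (Γ.auto g k)^[n] x = g ^ n * x * Γ.Δ ^ (n * k) := by
  induction n with
  | zero => simp
  | succ n ih =>
    rw [Function.iterate_succ_apply', ih, auto_apply, pow_succ']
    push_cast
    rw [add_mul, zpow_add]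
    simp [mul_assoc]

/-- If `Δ^{nm+1} ≤ gⁿ` for some `n ≥ 1`, then some `z` satisfies `zΔ ≤ g^N z Δ^{-Nm}`. -/
lemma exists_good (g : G) (m : ℤ) (n : ℕ)
    (h : leL Γ.P (Γ.Δ ^ (((n + 1 : ℕ) : ℤ) * m + 1)) (g ^ (n + 1))) :
    ∃ z, leL Γ.P (z * Γ.Δ)
      (g ^ (Γ.norm Γ.Δ) * z * Γ.Δ ^ ((Γ.norm Γ.Δ : ℤ) * (-m))) := by
  letI := Γ.lat
  have comm : ∀ x, Γ.auto g (-m) (Γ.auto 1 1 x) = Γ.auto 1 1 (Γ.auto g (-m) x) := by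
    intro x
    simp only [auto_apply, one_mul, mul_assoc, ← zpow_add, add_comm]
  have hR : ∀ x, x ≤ Γ.auto 1 1 x := by
    intro x
    change leL Γ.P x (1 * x * Γ.Δ ^ (1:ℤ))
    simpa [leL] using Γ.Δ_mem
  have hn : Γ.auto 1 1 1 ≤ (Γ.auto g (-m))^[n+1] 1 := by
    rw [auto_iterate]
    change leL Γ.P (1 * 1 * Γ.Δ ^ (1:ℤ)) _
    have := Γ.leL_mul_zpow (((n + 1 : ℕ) : ℤ) * (-m)) h
    rw [← zpow_add] at this
    have e : (((n + 1 : ℕ) : ℤ) * m + 1) + ((n + 1 : ℕ) : ℤ) * (-m) = 1 := by ring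
    rw [e] at this
    simpa only [mul_one, one_mul] using this
  obtain ⟨z, hz1, hz2⟩ := core_join _ _ comm hR 1 n hn
  have := core_chain _ _ comm z hz1 (hR z) (n+1) hz2 (Γ.norm Γ.Δ) (fun a => Γ.norm (z⁻¹ * a)) ?_ ?_
  · rw [auto_iterate, auto_apply] at this
    refine ⟨z, ?_⟩
    rw [one_mul, zpow_one] at this
    exact this
  · intro a b hza hab _
    have h1 : a⁻¹ * b ∈ Γ.P := hab.le
    have h2 : z⁻¹ * a ∈ Γ.P := hza
    have h3 : a⁻¹ * b ≠ 1 := fun e => hab.ne (inv_mul_eq_one.1 e)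
    have h4 := Γ.norm_mul _ _ h2 h1
    have h5 := Γ.norm_pos _ h1 h3
    have e : z⁻¹ * a * (a⁻¹ * b) = z⁻¹ * b := by simp [mul_assoc]
    rw [e] at h4
    change Γ.norm (z⁻¹ * a) + 1 ≤ Γ.norm (z⁻¹ * b)
    omega
  · simp [auto_apply]

lemma good_bound (g : G) (m : ℤ) (N : ℕ) (z : G)
    (h : leL Γ.P (z * Γ.Δ) (g ^ N * z * Γ.Δ ^ ((N : ℤ) * (-m)))) :
    ∃ C : ℤ, ∀ r : ℕ, (r : ℤ) + N * r * m - C ≤ Γ.zinf (g ^ (N * r)) := by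
  have h1 : leL Γ.P (z * Γ.Δ ^ ((N : ℤ) * m + 1)) (g ^ N * z) := by
    have := Γ.leL_mul_zpow ((N : ℤ) * m) h
    rw [mul_assoc _ (Γ.Δ ^ _), ← zpow_add, mul_assoc z, ← zpow_one_add] at this
    simpa [add_comm] using this
  have h2 : ∀ r : ℕ, leL Γ.P (z * Γ.Δ ^ (((N : ℤ) * m + 1) * r)) (g ^ (N * r) * z) := by
    intro r
    induction r with
    | zero => simp [leL, Γ.P.one_mem]
    | succ r ih =>
      have a1 := Γ.leL_mul_zpow ((N : ℤ) * m + 1) ih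
      have a2 := (Γ.leL_mul (g ^ (N * r))).2 h1
      rw [← mul_assoc] at a2
      have a3 := Γ.leL_trans a1 a2
      rw [mul_assoc z, ← zpow_add, ← mul_assoc (g ^ _), ← pow_add] at a3
      have e : ((N : ℤ) * m + 1) * ((r + 1 : ℕ) : ℤ) = ((N : ℤ) * m + 1) * r + (N * m + 1) := by
        push_cast; ring
      rw [e, Nat.mul_succ]
      exact a3
  refine ⟨Γ.zsup z - Γ.zinf z, fun r => ?_⟩
  apply (Γ.zinf_spec _).2
  change leL Γ.P _ _
  have b1 := Γ.leL_mul_zpow (((N : ℤ) * m + 1) * r) (Γ.zinf_le z)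
  have b2 := (Γ.leL_mul (g ^ (N * r))).2 (Γ.zsup_spec z).1
  have b3 := Γ.leL_mul_zpow (-Γ.zsup z) (Γ.leL_trans (Γ.leL_trans b1 (h2 r)) b2)
  rw [mul_assoc (g ^ _), ← zpow_add, ← zpow_add, ← zpow_add, add_neg_cancel, zpow_zero,
    mul_one] at b3
  convert b3 using 2
  ring

end GarsideGroup

/-- For every `g`, the fractional part of `t_inf(g)` does not lie in
`(0, 1/N)`: it is `0` or at least `1/N`. -/
theorem statement5 {G : Type*} [Group G] (Γ : GarsideGroup G) (g : G) :
    Int.fract (Γ.tinf g) = 0 ∨ 1 / (Γ.norm Γ.Δ : ℝ) ≤ Int.fract (Γ.tinf g) := by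
  by_cases h0 : Int.fract (Γ.tinf g) = 0
  · exact Or.inl h0
  right
  rcases Nat.eq_zero_or_pos (Γ.norm Γ.Δ) with hN | hN
  · rw [hN]; simp
  have hpos : 0 < Int.fract (Γ.tinf g) := lt_of_le_of_ne (Int.fract_nonneg _) (Ne.symm h0)
  have hlt : ((⌊Γ.tinf g⌋ : ℤ) : ℝ) < Γ.tinf g := by
    have := Int.self_sub_floor (Γ.tinf g); linarith
  obtain ⟨n, hn1, hn2⟩ :=
    (((Γ.tinf_spec g).eventually (lt_mem_nhds hlt)).and (eventually_ge_atTop 1)).exists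
  obtain ⟨n, rfl⟩ : ∃ k, n = k + 1 := ⟨n - 1, by omega⟩
  have hn3 : ((n + 1 : ℕ) : ℤ) * ⌊Γ.tinf g⌋ + 1 ≤ Γ.zinf (g ^ (n + 1)) := by
    rw [lt_div_iff₀ (by positivity)] at hn1
    have : ⌊Γ.tinf g⌋ * ((n + 1 : ℕ) : ℤ) < Γ.zinf (g ^ (n + 1)) := by exact_mod_cast hn1
    rw [mul_comm]; omega
  obtain ⟨z, hz⟩ := Γ.exists_good g ⌊Γ.tinf g⌋ n (Γ.leL_trans (Γ.leL_zpow hn3) (Γ.zinf_le _))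
  obtain ⟨C, hC⟩ := Γ.good_bound g _ _ z hz
  set N := Γ.norm Γ.Δ with hNdef
  set m := ⌊Γ.tinf g⌋ with hm
  have hNR : (0 : ℝ) < N := by exact_mod_cast hN
  have t1 : Tendsto (fun r : ℕ => (Γ.zinf (g ^ (N * r)) : ℝ) / ((N * r : ℕ) : ℝ)) atTop
      (nhds (Γ.tinf g)) :=
    (Γ.tinf_spec g).comp (tendsto_id.const_mul_atTop' hN)
  have t2 : Tendsto (fun r : ℕ => (1 / (N : ℝ) + m) - (C / N : ℝ) / (r : ℝ)) atTop
      (nhds ((1 / (N : ℝ) + m) - 0)) :=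
    tendsto_const_nhds.sub (tendsto_const_div_atTop_nhds_zero_nat _)
  have t3 : (1 / (N : ℝ) + m) - 0 ≤ Γ.tinf g := by
    refine le_of_tendsto_of_tendsto t2 t1 ?_
    filter_upwards [eventually_ge_atTop 1] with r hr
    have hrR : (0 : ℝ) < r := by exact_mod_cast hr
    have hc : ((r : ℝ) + N * r * m - C) ≤ (Γ.zinf (g ^ (N * r)) : ℝ) := by exact_mod_cast hC r
    push_cast
    rw [le_div_iff₀ (by positivity)]
    refine le_trans (le_of_eq ?_) hc
    field_simp
  have := Int.self_sub_floor (Γ.tinf g)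
  linarith
end

section
/- Let G be a Garside group with Garside element Δ, and for g ∈ G define t_inf(g) = limsup_{n→∞} inf(gⁿ)/n. Then for all g, h ∈ G: (i) t_inf(h⁻¹gh) = t_inf(g); (ii) the limit lim_{n→∞} inf(gⁿ)/n exists and equals t_inf(g); (iii) inf_s(g) ≤ t_inf(g) ≤ inf_s(g) + 1; (iv) t_inf(gⁿ) = n·t_inf(g) for every integer n ≥ 1. -/
open Filter Topology Pointwise

/-- `t_inf(g)` defined as `limsup_{n→∞} inf(gⁿ)/n`. -/
noncomputable def tinfLimsup {G : Type*} [Group G] (Γ : GarsideGroup G) (g : G) : ℝ :=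
  Filter.limsup (fun n : ℕ => (Γ.zinf (g ^ n) : ℝ) / (n : ℝ)) Filter.atTop

section Helpers

variable {G : Type*} [Group G] (Γ : GarsideGroup G)

theorem aux_conj_pos (a : G) (ha : a ∈ Γ.P) : Γ.Δ⁻¹ * a * Γ.Δ ∈ Γ.P := by
  have ha' := ha
  rw [← Γ.simples_gen] at ha'
  induction ha' using Submonoid.closure_induction with
  | mem a h =>
    obtain ⟨h1, h2⟩ := h
    have hb : leL Γ.P (a⁻¹ * Γ.Δ) Γ.Δ := by
      rw [Γ.Δ_balanced _ h2]
      simpa [leR] using h1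
    simpa [leL] using hb
  | one => simp
  | mul x y hx hy ihx ihy =>
    rw [Γ.simples_gen] at hx hy
    have := Γ.P.mul_mem (ihx hx) (ihy hy)
    convert this using 1
    group

theorem aux_conj_neg (a : G) (ha : a ∈ Γ.P) : Γ.Δ * a * Γ.Δ⁻¹ ∈ Γ.P := by
  have ha' := ha
  rw [← Γ.simples_gen] at ha'
  induction ha' using Submonoid.closure_induction with
  | mem a h =>
    obtain ⟨h1, h2⟩ := h
    have h3 : leR Γ.P a Γ.Δ := (Γ.Δ_balanced _ h1).1 h2
    have hb : leR Γ.P (Γ.Δ * a⁻¹) Γ.Δ := by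
      rw [← Γ.Δ_balanced _ h3]
      simpa [leL] using h1
    simpa [leR, mul_assoc] using hb
  | one => simp
  | mul x y hx hy ihx ihy =>
    rw [Γ.simples_gen] at hx hy
    have := Γ.P.mul_mem (ihx hx) (ihy hy)
    convert this using 1
    group

theorem aux_conj_zpow (k : ℤ) : ∀ a ∈ Γ.P, (Γ.Δ ^ k)⁻¹ * a * Γ.Δ ^ k ∈ Γ.P := by
  induction k with
  | zero => simp
  | succ n ih =>
    intro a ha
    have := aux_conj_pos Γ _ (ih a ha)
    convert this using 1
    rw [zpow_add_one]; group
  | pred n ih =>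
    intro a ha
    have := aux_conj_neg Γ _ (ih a ha)
    convert this using 1
    rw [zpow_sub_one]; group

theorem aux_leL_refl (P : Submonoid G) (a : G) : leL P a a := by simp [leL]

theorem aux_leL_trans {P : Submonoid G} {a b c : G} (h : leL P a b) (h' : leL P b c) :
    leL P a c := by
  have := P.mul_mem h h'
  simpa [leL, mul_assoc] using this

theorem aux_leL_mul_left {P : Submonoid G} (x : G) {a b : G} :
    leL P (x * a) (x * b) ↔ leL P a b := by
  simp [leL, mul_assoc]

theorem aux_leL_mul_right (k : ℤ) {a b : G} (h : leL Γ.P a b) :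
    leL Γ.P (a * Γ.Δ ^ k) (b * Γ.Δ ^ k) := by
  have := aux_conj_zpow Γ k _ h
  simpa [leL, mul_assoc] using this

theorem aux_superadd (g h : G) : Γ.zinf g + Γ.zinf h ≤ Γ.zinf (g * h) := by
  apply (Γ.zinf_spec (g * h)).2
  have h1 : leL Γ.P (Γ.Δ ^ Γ.zinf g) g := (Γ.zinf_spec g).1
  have h2 : leL Γ.P (Γ.Δ ^ Γ.zinf h) h := (Γ.zinf_spec h).1
  change leL Γ.P _ _
  rw [zpow_add]
  exact aux_leL_trans (aux_leL_mul_right Γ _ h1) ((aux_leL_mul_left g).2 h2)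

theorem aux_zinf_one : 0 ≤ Γ.zinf 1 := by
  apply (Γ.zinf_spec 1).2
  simp [leL]

theorem aux_zinf_pow (g : G) (n : ℕ) : n * Γ.zinf g ≤ Γ.zinf (g ^ n) := by
  induction n with
  | zero => simpa using aux_zinf_one Γ
  | succ n ih =>
    have := aux_superadd Γ (g ^ n) g
    rw [pow_succ]
    push_cast
    linarith

/-- The limit of `inf(gⁿ)/n` exists (Fekete). -/
theorem aux_limit_exists (g : G) : ∃ t : ℝ,
    Tendsto (fun n : ℕ => (Γ.zinf (g ^ n) : ℝ) / (n : ℝ)) atTop (nhds t) := by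
  have hs : Subadditive (fun n : ℕ => -(Γ.zinf (g ^ n) : ℝ)) := by
    intro m n
    have := aux_superadd Γ (g ^ m) (g ^ n)
    rw [← pow_add] at this
    have h : ((Γ.zinf (g ^ m) : ℝ)) + Γ.zinf (g ^ n) ≤ Γ.zinf (g ^ (m + n)) := by
      exact_mod_cast this
    linarith
  have hb : BddBelow (Set.range fun n : ℕ => -(Γ.zinf (g ^ n) : ℝ) / n) := by
    refine ⟨-(|(Γ.zinf 1 : ℝ)| + |(Γ.zinf g⁻¹ : ℝ)|), ?_⟩
    rintro _ ⟨n, rfl⟩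
    rcases Nat.eq_zero_or_pos n with rfl | hn
    · simp only [Nat.cast_zero, div_zero]
      have := abs_nonneg (Γ.zinf 1 : ℝ)
      have := abs_nonneg (Γ.zinf g⁻¹ : ℝ)
      linarith
    · have hn' : (1 : ℝ) ≤ n := by exact_mod_cast hn
      have h1 := aux_superadd Γ (g ^ n) (g⁻¹ ^ n)
      have h2 := aux_zinf_pow Γ g⁻¹ n
      have h3 : g ^ n * g⁻¹ ^ n = 1 := by simp
      rw [h3] at h1
      have h4 : (Γ.zinf (g ^ n) : ℝ) + n * Γ.zinf g⁻¹ ≤ Γ.zinf 1 := by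
        exact_mod_cast (by linarith : Γ.zinf (g ^ n) + n * Γ.zinf g⁻¹ ≤ Γ.zinf 1)
      simp only
      rw [le_div_iff₀ (by linarith)]
      have h5 := le_abs_self (Γ.zinf 1 : ℝ)
      have h6 := neg_abs_le (Γ.zinf g⁻¹ : ℝ)
      have h7 := abs_nonneg (Γ.zinf 1 : ℝ)
      nlinarith
  refine ⟨-hs.lim, ?_⟩
  have := (hs.tendsto_lim hb).neg
  refine this.congr fun n => ?_
  ring

theorem aux_tendsto (g : G) :
    Tendsto (fun n : ℕ => (Γ.zinf (g ^ n) : ℝ) / (n : ℝ)) atTop (nhds (tinfLimsup Γ g)) := by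
  obtain ⟨t, ht⟩ := aux_limit_exists Γ g
  have : tinfLimsup Γ g = t := ht.limsup_eq
  rwa [this]

/-- Binary meets in the whole group. -/
theorem aux_meet (a b : G) : ∃ m, leL Γ.P m a ∧ leL Γ.P m b ∧
    ∀ d, leL Γ.P d a → leL Γ.P d b → leL Γ.P d m := by
  have key : ∀ a ∈ Γ.P, ∀ b ∈ Γ.P, ∃ m, leL Γ.P m a ∧ leL Γ.P m b ∧
      ∀ d, leL Γ.P d a → leL Γ.P d b → leL Γ.P d m := by
    intro a ha b hb
    obtain ⟨⟨c, hc, hca, hcb, hc'⟩, -⟩ := Γ.latticeL a ha b hb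
    refine ⟨c, hca, hcb, fun d hda hdb => ?_⟩
    obtain ⟨p, q, hp, hq, rfl⟩ := Γ.fraction d
    obtain ⟨⟨e, he, hea, heb, he'⟩, -⟩ :=
      Γ.latticeL (p * a) (Γ.P.mul_mem hp ha) (p * b) (Γ.P.mul_mem hp hb)
    have h1 : leL Γ.P q e := by
      apply he' q hq
      · simpa [leL, mul_assoc] using hda
      · simpa [leL, mul_assoc] using hdb
    have h2 : leL Γ.P p e := by
      apply he' p hp
      · simpa [leL] using ha
      · simpa [leL] using hb
    have h3 : leL Γ.P (p⁻¹ * e) c := by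
      apply hc' _ h2
      · simpa [leL, mul_assoc] using hea
      · simpa [leL, mul_assoc] using heb
    exact aux_leL_trans ((aux_leL_mul_left p⁻¹).2 h1) h3
  obtain ⟨p1, q1, hp1, hq1, rfl⟩ := Γ.fraction a
  obtain ⟨p2, q2, hp2, hq2, h⟩ := Γ.fraction (p1 * b)
  obtain ⟨m, h1, h2, h3⟩ := key (p2 * q1) (Γ.P.mul_mem hp2 hq1) q2 hq2
  have hb : b = (p2 * p1)⁻¹ * q2 := by
    rw [mul_inv_rev, mul_assoc, ← h]; simp
  have ha : p1⁻¹ * q1 = (p2 * p1)⁻¹ * (p2 * q1) := by group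
  rw [ha, hb]
  refine ⟨(p2 * p1)⁻¹ * m, (aux_leL_mul_left _).2 h1, (aux_leL_mul_left _).2 h2, ?_⟩
  intro d hd1 hd2
  have e : d = (p2 * p1)⁻¹ * ((p2 * p1) * d) := by rw [inv_mul_cancel_left]
  rw [e, aux_leL_mul_left] at hd1 hd2 ⊢
  exact h3 _ hd1 hd2

/-- Finite nonempty meets. -/
theorem aux_meets (f : ℕ → G) (n : ℕ) : ∃ m, (∀ i ≤ n, leL Γ.P m (f i)) ∧
    ∀ d, (∀ i ≤ n, leL Γ.P d (f i)) → leL Γ.P d m := by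
  induction n with
  | zero =>
    refine ⟨f 0, ?_, fun d hd => hd 0 le_rfl⟩
    intro i hi
    obtain rfl : i = 0 := by omega
    exact aux_leL_refl _ _
  | succ n ih =>
    obtain ⟨m, h1, h2⟩ := ih
    obtain ⟨m', h3, h4, h5⟩ := aux_meet Γ m (f (n + 1))
    refine ⟨m', ?_, ?_⟩
    · intro i hi
      rcases Nat.lt_or_ge n i with h | h
      · obtain rfl : i = n + 1 := by omega
        exact h4
      · exact aux_leL_trans h3 (h1 i h)
    · intro d hd
      exact h5 d (h2 d fun i hi => hd i (by omega)) (hd _ le_rfl)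

/-- If `Δ^{(n+1)k} ≤ g^{n+1}` then `k ≤ inf_s g`. -/
theorem aux_infs (g : G) (k : ℤ) (n : ℕ) (h : (n + 1 : ℤ) * k ≤ Γ.zinf (g ^ (n + 1))) :
    k ≤ Γ.infs g := by
  have h1 : leL Γ.P 1 (g ^ (n + 1) * Γ.Δ ^ (-((n + 1 : ℤ) * k))) := by
    have e1 : leL Γ.P (Γ.Δ ^ Γ.zinf (g ^ (n + 1))) (g ^ (n + 1)) := (Γ.zinf_spec _).1
    have e2 : leL Γ.P (Γ.Δ ^ ((n + 1 : ℤ) * k)) (Γ.Δ ^ Γ.zinf (g ^ (n + 1))) := by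
      obtain ⟨j, hj⟩ := Int.le.dest h
      rw [← hj, zpow_add, leL]
      simpa using Γ.P.pow_mem Γ.Δ_mem j
    have := aux_leL_mul_right Γ (-((n + 1 : ℤ) * k)) (aux_leL_trans e2 e1)
    simpa using this
  obtain ⟨m, hm, hm'⟩ := aux_meets Γ (fun i => g ^ i * Γ.Δ ^ (-((i : ℤ) * k))) n
  have hmain : leL Γ.P (g⁻¹ * (m * Γ.Δ ^ k)) m := by
    apply hm'
    intro i hi
    rw [← aux_leL_mul_left g]
    have e : g * (g ^ i * Γ.Δ ^ (-((i : ℤ) * k))) =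
        (g ^ (i + 1) * Γ.Δ ^ (-(((i + 1 : ℕ) : ℤ) * k))) * Γ.Δ ^ k := by
      rw [mul_assoc, ← zpow_add, pow_succ', mul_assoc]
      congr 3
      push_cast; ring
    rw [e, mul_inv_cancel_left]
    apply aux_leL_mul_right
    rcases Nat.lt_or_ge i n with h2 | h2
    · exact hm (i + 1) h2
    · obtain rfl : i = n := by omega
      have := hm 0 (Nat.zero_le _)
      simp only [pow_zero, Nat.cast_zero, zero_mul, neg_zero, zpow_zero, mul_one] at this
      refine aux_leL_trans this ?_
      simpa using h1
  have h2 : k ≤ Γ.zinf (m⁻¹ * g * m) := by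
    apply (Γ.zinf_spec _).2
    simpa [leL, mul_assoc] using hmain
  exact h2.trans ((Γ.infs_spec g).2 ⟨m, rfl⟩)

theorem aux_conj_pow (g h : G) (n : ℕ) : (h⁻¹ * g * h) ^ n = h⁻¹ * g ^ n * h := by
  induction n with
  | zero => simp
  | succ n ih => rw [pow_succ, ih, pow_succ]; group

theorem aux_conj_le (g h : G) : tinfLimsup Γ g ≤ tinfLimsup Γ (h⁻¹ * g * h) := by
  have h1 := aux_tendsto Γ g
  have h2 := aux_tendsto Γ (h⁻¹ * g * h)
  have h3 : Tendsto (fun n : ℕ => ((Γ.zinf h⁻¹ + Γ.zinf h : ℤ) : ℝ) / (n : ℝ)) atTop (nhds 0) :=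
    tendsto_const_div_atTop_nhds_zero_nat _
  have h4 := h1.add h3
  rw [add_zero] at h4
  refine le_of_tendsto_of_tendsto' h4 h2 fun n => ?_
  rw [← add_div]
  apply div_le_div_of_nonneg_right _ (Nat.cast_nonneg n)
  rw [aux_conj_pow]
  have e1 := aux_superadd Γ h⁻¹ (g ^ n)
  have e2 := aux_superadd Γ (h⁻¹ * g ^ n) h
  exact_mod_cast (by linarith :
    Γ.zinf (g ^ n) + (Γ.zinf h⁻¹ + Γ.zinf h) ≤ Γ.zinf (h⁻¹ * g ^ n * h))

theorem aux_conj_eq (g h : G) : tinfLimsup Γ (h⁻¹ * g * h) = tinfLimsup Γ g := by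
  apply le_antisymm _ (aux_conj_le Γ g h)
  have := aux_conj_le Γ (h⁻¹ * g * h) h⁻¹
  have e : h⁻¹⁻¹ * (h⁻¹ * g * h) * h⁻¹ = g := by group
  rwa [e] at this

theorem aux_zinf_le (g : G) : (Γ.zinf g : ℝ) ≤ tinfLimsup Γ g := by
  refine ge_of_tendsto (aux_tendsto Γ g) ?_
  filter_upwards [eventually_gt_atTop 0] with n hn
  have hn' : (0 : ℝ) < n := by exact_mod_cast hn
  rw [le_div_iff₀ hn', mul_comm]
  exact_mod_cast aux_zinf_pow Γ g n

end Helpers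

/-- with `t_inf(g) = limsup inf(gⁿ)/n`: (i) `t_inf(h⁻¹gh) = t_inf(g)`;
(ii) the limit `lim inf(gⁿ)/n` exists and equals `t_inf(g)`;
(iii) `inf_s(g) ≤ t_inf(g) ≤ inf_s(g) + 1`; (iv) `t_inf(gⁿ) = n·t_inf(g)` for `n ≥ 1`. -/
theorem statement10 {G : Type*} [Group G] (Γ : GarsideGroup G) :
    (∀ g h : G, tinfLimsup Γ (h⁻¹ * g * h) = tinfLimsup Γ g) ∧
    (∀ g : G, Filter.Tendsto (fun n : ℕ => (Γ.zinf (g ^ n) : ℝ) / (n : ℝ))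
      Filter.atTop (nhds (tinfLimsup Γ g))) ∧
    (∀ g : G, (Γ.infs g : ℝ) ≤ tinfLimsup Γ g ∧ tinfLimsup Γ g ≤ (Γ.infs g : ℝ) + 1) ∧
    (∀ (g : G) (n : ℕ), 1 ≤ n → tinfLimsup Γ (g ^ n) = (n : ℝ) * tinfLimsup Γ g) := by
  refine ⟨aux_conj_eq Γ, aux_tendsto Γ, fun g => ⟨?_, ?_⟩, ?_⟩
  · obtain ⟨h, hh⟩ := (Γ.infs_spec g).1
    rw [← hh, ← aux_conj_eq Γ g h]
    exact aux_zinf_le Γ _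
  · by_contra! hlt
    obtain ⟨n, hn, hn0⟩ := (((aux_tendsto Γ g).eventually_const_lt hlt).and
      (eventually_gt_atTop 0)).exists
    obtain ⟨m, rfl⟩ : ∃ m, n = m + 1 := ⟨n - 1, by omega⟩
    have hn' : (0 : ℝ) < ((m + 1 : ℕ) : ℝ) := by exact_mod_cast hn0
    rw [lt_div_iff₀ hn'] at hn
    have h1 : (m + 1 : ℤ) * (Γ.infs g + 1) ≤ Γ.zinf (g ^ (m + 1)) := by
      have : (Γ.infs g + 1) * (m + 1 : ℤ) < Γ.zinf (g ^ (m + 1)) := by exact_mod_cast hn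
      linarith
    have := aux_infs Γ g _ m h1
    omega
  · intro g n hn
    have hn' : (n : ℝ) ≠ 0 := by
      have : n ≠ 0 := by omega
      exact_mod_cast this
    have h1 := aux_tendsto Γ (g ^ n)
    have h2 : Tendsto (fun m : ℕ => n * m) atTop atTop :=
      tendsto_id.const_mul_atTop' (by omega)
    have h3 := ((aux_tendsto Γ g).comp h2).const_mul (n : ℝ)
    refine tendsto_nhds_unique h1 (h3.congr fun m => ?_)
    simp only [Function.comp, pow_mul, Nat.cast_mul]
    field_simp
end

section
/- Let G be a Garside group with Garside element Δ. If g ∈ G is inf-straight, then for every integer n ≥ 1 the element gⁿ is also inf-straight and inf_s(gⁿ) = n·inf(g). -/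
open Filter Topology Pointwise

namespace GarsideGroup

variable {G : Type*} [Group G] (Γ : GarsideGroup G)

lemma conj_mem (a : G) (ha : a ∈ Γ.P) : Γ.Δ⁻¹ * a * Γ.Δ ∈ Γ.P := by
  have h : Γ.P ≤ Γ.P.comap (MulAut.conj Γ.Δ⁻¹).toMonoidHom := by
    conv_lhs => rw [← Γ.simples_gen]
    rw [Submonoid.closure_le]
    rintro a ⟨ha, hb⟩
    have hR : leR Γ.P (a⁻¹ * Γ.Δ) Γ.Δ := by
      unfold leR
      convert ha using 1
      group
    have hL := (Γ.Δ_balanced _ hb).2 hR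
    unfold leL at hL
    simp only [SetLike.mem_coe, Submonoid.mem_comap]
    convert hL using 1
    simp [MulAut.conj_apply, mul_assoc]
  have := h ha
  simpa [MulAut.conj_apply] using this

lemma conj_mem' (a : G) (ha : a ∈ Γ.P) : Γ.Δ * a * Γ.Δ⁻¹ ∈ Γ.P := by
  have h : Γ.P ≤ Γ.P.comap (MulAut.conj Γ.Δ).toMonoidHom := by
    conv_lhs => rw [← Γ.simples_gen]
    rw [Submonoid.closure_le]
    rintro a ⟨ha, hb⟩
    have hb' : Γ.Δ * a⁻¹ ∈ Γ.P := (Γ.Δ_balanced _ ha).1 hb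
    have hL : leL Γ.P (Γ.Δ * a⁻¹) Γ.Δ := by
      unfold leL
      convert ha using 1
      group
    have hR := (Γ.Δ_balanced _ hb').1 hL
    unfold leR at hR
    simp only [SetLike.mem_coe, Submonoid.mem_comap]
    convert hR using 1
    simp [MulAut.conj_apply, mul_assoc]
  have := h ha
  simpa [MulAut.conj_apply] using this

lemma conj_zpow_mem (s : ℤ) : ∀ a ∈ Γ.P, (Γ.Δ ^ s)⁻¹ * a * Γ.Δ ^ s ∈ Γ.P := by
  induction s using Int.induction_on with
  | zero => intro a ha; simpa using ha
  | succ n ih =>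
    intro a ha
    have := Γ.conj_mem _ (ih a ha)
    convert this using 1
    rw [zpow_add_one]; group
  | pred n ih =>
    intro a ha
    have := Γ.conj_mem' _ (ih a ha)
    convert this using 1
    rw [zpow_sub_one]; group

lemma zinf_mul (g h : G) : Γ.zinf g + Γ.zinf h ≤ Γ.zinf (g * h) := by
  apply (Γ.zinf_spec (g * h)).2
  have h1 := (Γ.zinf_spec g).1
  have h2 := (Γ.zinf_spec h).1
  simp only [Set.mem_setOf_eq, leL] at h1 h2 ⊢
  have := Γ.P.mul_mem (Γ.conj_zpow_mem (Γ.zinf h) _ h1) h2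
  convert this using 1
  rw [zpow_add]; group

lemma zinf_pow (g : G) (n : ℕ) (hn : 1 ≤ n) : (n : ℤ) * Γ.zinf g ≤ Γ.zinf (g ^ n) := by
  induction n, hn using Nat.le_induction with
  | base => simp
  | succ n hn ih =>
    have := Γ.zinf_mul (g ^ n) g
    rw [pow_succ]
    push_cast
    linarith

lemma zinf_le_tinf (g : G) : (Γ.zinf g : ℝ) ≤ Γ.tinf g := by
  refine ge_of_tendsto (Γ.tinf_spec g) ?_
  filter_upwards [eventually_ge_atTop 1] with n hn
  have h0 : (0 : ℝ) < n := by exact_mod_cast hn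
  rw [le_div_iff₀ h0, mul_comm]
  exact_mod_cast Γ.zinf_pow g n hn

lemma tinf_pow (g : G) (n : ℕ) (hn : 1 ≤ n) : Γ.tinf (g ^ n) = n * Γ.tinf g := by
  refine tendsto_nhds_unique (Γ.tinf_spec (g ^ n)) ?_
  have h1 : Tendsto (fun k : ℕ => n * k) atTop atTop :=
    tendsto_id.const_mul_atTop' (by omega)
  have h2 := ((Γ.tinf_spec g).comp h1).const_mul (n : ℝ)
  refine h2.congr fun k => ?_
  have h0 : (n : ℝ) ≠ 0 := by
    have : n ≠ 0 := by omega
    exact_mod_cast this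
  simp only [Function.comp, ← pow_mul]
  push_cast
  rw [mul_div_assoc', mul_div_mul_left _ _ h0]

lemma tinf_conj_le (g h : G) : Γ.tinf (h⁻¹ * g * h) ≤ Γ.tinf g := by
  have h1 := tendsto_const_div_atTop_nhds_zero_nat ((Γ.zinf h + Γ.zinf h⁻¹ : ℤ) : ℝ)
  have h2 := (Γ.tinf_spec (h⁻¹ * g * h)).add h1
  rw [add_zero] at h2
  refine le_of_tendsto_of_tendsto' h2 (Γ.tinf_spec g) fun k => ?_
  rw [← add_div]
  apply div_le_div_of_nonneg_right _ (Nat.cast_nonneg k)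
  have e : g ^ k = h * (h⁻¹ * g * h) ^ k * h⁻¹ := by
    have := conj_pow (a := h⁻¹) (b := g) (i := k)
    rw [inv_inv] at this
    rw [this]; group
  have h3 := Γ.zinf_mul (h * (h⁻¹ * g * h) ^ k) h⁻¹
  have h4 := Γ.zinf_mul h ((h⁻¹ * g * h) ^ k)
  rw [← e] at h3
  have : Γ.zinf ((h⁻¹ * g * h) ^ k) + (Γ.zinf h + Γ.zinf h⁻¹) ≤ Γ.zinf (g ^ k) := by linarith
  exact_mod_cast this

end GarsideGroup

/-- if `g` is inf-straight, then for every `n ≥ 1`, `gⁿ` is inf-straight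
and `inf_s(gⁿ) = n·inf(g)`. -/
theorem statement12 {G : Type*} [Group G] (Γ : GarsideGroup G) (g : G)
    (hg : Γ.InfStraight g) :
    ∀ n : ℕ, 1 ≤ n → Γ.InfStraight (g ^ n) ∧ Γ.infs (g ^ n) = (n : ℤ) * Γ.zinf g := by
  intro n hn
  unfold GarsideGroup.InfStraight at hg ⊢
  have h1 : ((n : ℤ) * Γ.zinf g : ℤ) ≤ Γ.zinf (g ^ n) := Γ.zinf_pow g n hn
  have h1' : (n : ℝ) * Γ.zinf g ≤ Γ.zinf (g ^ n) := by exact_mod_cast h1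
  have h2 := Γ.zinf_le_tinf (g ^ n)
  have h3 := Γ.tinf_pow g n hn
  rw [← hg] at h3
  refine ⟨by linarith, le_antisymm ?_ ?_⟩
  · obtain ⟨x, hx⟩ := (Γ.infs_spec (g ^ n)).1
    simp only at hx
    rw [← hx]
    have h4 := Γ.zinf_le_tinf (x⁻¹ * g ^ n * x)
    have h5 := Γ.tinf_conj_le (g ^ n) x
    have h6 : (Γ.zinf (x⁻¹ * g ^ n * x) : ℝ) ≤ n * Γ.zinf g := by linarith
    exact_mod_cast h6
  · refine h1.trans ((Γ.infs_spec (g ^ n)).2 ⟨1, ?_⟩)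
    simp
end

section
/- Let G be a Garside group with Garside element Δ. If g ∈ G is sup-straight, then for every integer n ≥ 1 the element gⁿ is also sup-straight and sup_s(gⁿ) = n·sup(g). -/
open Filter Topology Pointwise

theorem GarsideGroup.conj_mem_s13 {G : Type*} [Group G] (Γ : GarsideGroup G) (a : G)
    (ha : a ∈ Γ.P) : Γ.Δ⁻¹ * a * Γ.Δ ∈ Γ.P ∧ Γ.Δ * a * Γ.Δ⁻¹ ∈ Γ.P := by
  have ha' := ha
  rw [← Γ.simples_gen] at ha'
  induction ha' using Submonoid.closure_induction with
  | mem x hx =>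
    obtain ⟨hxP, hxL⟩ := hx
    have hxR := (Γ.Δ_balanced x hxP).1 hxL
    constructor
    · have hb : leR Γ.P (x⁻¹ * Γ.Δ) Γ.Δ := by
        unfold leR
        have : Γ.Δ * (x⁻¹ * Γ.Δ)⁻¹ = x := by group
        rw [this]; exact hxP
      have := (Γ.Δ_balanced _ hxL).2 hb
      unfold leL at this
      have e : Γ.Δ⁻¹ * x * Γ.Δ = (x⁻¹ * Γ.Δ)⁻¹ * Γ.Δ := by group
      rw [e]; exact this
    · have hb : leL Γ.P (Γ.Δ * x⁻¹) Γ.Δ := by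
        unfold leL
        have : (Γ.Δ * x⁻¹)⁻¹ * Γ.Δ = x := by group
        rw [this]; exact hxP
      have := (Γ.Δ_balanced _ hxR).1 hb
      unfold leR at this
      have e : Γ.Δ * x * Γ.Δ⁻¹ = Γ.Δ * (Γ.Δ * x⁻¹)⁻¹ := by group
      rw [e]; exact this
  | one => simp
  | mul x y hx hy ihx ihy =>
    rw [Γ.simples_gen] at hx hy
    have h1 := ihx hx
    have h2 := ihy hy
    constructor
    · have := Γ.P.mul_mem h1.1 h2.1
      have e : Γ.Δ⁻¹ * (x * y) * Γ.Δ = (Γ.Δ⁻¹ * x * Γ.Δ) * (Γ.Δ⁻¹ * y * Γ.Δ) := by group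
      rw [e]; exact this
    · have := Γ.P.mul_mem h1.2 h2.2
      have e : Γ.Δ * (x * y) * Γ.Δ⁻¹ = (Γ.Δ * x * Γ.Δ⁻¹) * (Γ.Δ * y * Γ.Δ⁻¹) := by group
      rw [e]; exact this

theorem GarsideGroup.conj_zpow_mem_s13 {G : Type*} [Group G] (Γ : GarsideGroup G) (t : ℤ) :
    ∀ a ∈ Γ.P, Γ.Δ ^ (-t) * a * Γ.Δ ^ t ∈ Γ.P := by
  induction t using Int.induction_on with
  | zero => intro a ha; simpa using ha
  | succ i ih =>
    intro a ha
    have := (Γ.conj_mem_s13 _ (ih a ha)).1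
    have e : Γ.Δ ^ (-((i : ℤ) + 1)) * a * Γ.Δ ^ ((i : ℤ) + 1)
        = Γ.Δ⁻¹ * (Γ.Δ ^ (-(i : ℤ)) * a * Γ.Δ ^ (i : ℤ)) * Γ.Δ := by group
    rw [e]; exact this
  | pred i ih =>
    intro a ha
    have := (Γ.conj_mem_s13 _ (ih a ha)).2
    have e : Γ.Δ ^ (-(-(i : ℤ) - 1)) * a * Γ.Δ ^ (-(i : ℤ) - 1)
        = Γ.Δ * (Γ.Δ ^ (-(-(i : ℤ))) * a * Γ.Δ ^ (-(i : ℤ))) * Γ.Δ⁻¹ := by group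
    rw [e]; exact this

theorem GarsideGroup.zsup_mul {G : Type*} [Group G] (Γ : GarsideGroup G) (a b : G) :
    Γ.zsup (a * b) ≤ Γ.zsup a + Γ.zsup b := by
  apply (Γ.zsup_spec (a * b)).2
  have h1 : a⁻¹ * Γ.Δ ^ Γ.zsup a ∈ Γ.P := (Γ.zsup_spec a).1
  have h2 : b⁻¹ * Γ.Δ ^ Γ.zsup b ∈ Γ.P := (Γ.zsup_spec b).1
  have := Γ.P.mul_mem h2 (Γ.conj_zpow_mem_s13 (Γ.zsup b) _ h1)
  change (a * b)⁻¹ * Γ.Δ ^ (Γ.zsup a + Γ.zsup b) ∈ Γ.P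
  have e : (a * b)⁻¹ * Γ.Δ ^ (Γ.zsup a + Γ.zsup b) = b⁻¹ * Γ.Δ ^ Γ.zsup b *
      (Γ.Δ ^ (-Γ.zsup b) * (a⁻¹ * Γ.Δ ^ Γ.zsup a) * Γ.Δ ^ Γ.zsup b) := by
    rw [zpow_add, zpow_neg]; group
  rw [e]; exact this

theorem GarsideGroup.zsup_pow {G : Type*} [Group G] (Γ : GarsideGroup G) (a : G) (k : ℕ) :
    Γ.zsup (a ^ k) ≤ k * Γ.zsup a := by
  induction k with
  | zero =>
    apply (Γ.zsup_spec _).2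
    simp [leL, Γ.P.one_mem]
  | succ k ih =>
    rw [pow_succ]
    have := Γ.zsup_mul (a ^ k) a
    push_cast
    linarith

theorem GarsideGroup.tsup_le_conj {G : Type*} [Group G] (Γ : GarsideGroup G) (x h : G) :
    Γ.tsup x ≤ (Γ.zsup (h⁻¹ * x * h) : ℝ) := by
  have hlim : Tendsto (fun k : ℕ => ((Γ.zsup h + Γ.zsup h⁻¹ : ℤ) : ℝ) / (k : ℝ) +
      (Γ.zsup (h⁻¹ * x * h) : ℝ)) atTop (𝓝 (0 + (Γ.zsup (h⁻¹ * x * h) : ℝ))) :=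
    (tendsto_const_div_atTop_nhds_zero_nat _).add tendsto_const_nhds
  rw [zero_add] at hlim
  refine le_of_tendsto_of_tendsto (Γ.tsup_spec x) hlim ?_
  filter_upwards [eventually_ge_atTop 1] with k hk
  have hk' : (0 : ℝ) < k := by exact_mod_cast hk
  have e : x ^ k = h * (h⁻¹ * x * h) ^ k * h⁻¹ := by
    have := conj_pow (i := k) (a := h) (b := h⁻¹ * x * h)
    rw [← this]; congr 1; group
  have h1 := Γ.zsup_mul (h * (h⁻¹ * x * h) ^ k) h⁻¹
  have h2 := Γ.zsup_mul h ((h⁻¹ * x * h) ^ k)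
  have h3 := Γ.zsup_pow (h⁻¹ * x * h) k
  rw [← e] at h1
  have h4 : Γ.zsup (x ^ k) ≤ (Γ.zsup h + Γ.zsup h⁻¹) + k * Γ.zsup (h⁻¹ * x * h) := by
    linarith
  have h5 : (Γ.zsup (x ^ k) : ℝ) ≤ ((Γ.zsup h + Γ.zsup h⁻¹ : ℤ) : ℝ)
      + k * (Γ.zsup (h⁻¹ * x * h) : ℝ) := by exact_mod_cast h4
  rw [div_le_iff₀ hk', add_mul, div_mul_cancel₀ _ hk'.ne']
  linarith

theorem GarsideGroup.tsup_pow {G : Type*} [Group G] (Γ : GarsideGroup G) (x : G) (n : ℕ)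
    (hn : 1 ≤ n) : Γ.tsup (x ^ n) = n * Γ.tsup x := by
  have hn' : (n : ℝ) ≠ 0 := by positivity
  have h1 : Tendsto (fun k : ℕ => n * k) atTop atTop :=
    tendsto_id.const_mul_atTop' hn
  have h2 := ((Γ.tsup_spec x).comp h1).const_mul (n : ℝ)
  refine tendsto_nhds_unique (Γ.tsup_spec (x ^ n)) (h2.congr fun k => ?_)
  simp only [Function.comp, pow_mul, Nat.cast_mul]
  rw [← mul_div_assoc, mul_div_mul_left _ _ hn']

/-- if `g` is sup-straight, then for every `n ≥ 1`, `gⁿ` is sup-straight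
and `sup_s(gⁿ) = n·sup(g)`. -/
theorem statement13 {G : Type*} [Group G] (Γ : GarsideGroup G) (g : G)
    (hg : Γ.SupStraight g) :
    ∀ n : ℕ, 1 ≤ n → Γ.SupStraight (g ^ n) ∧ Γ.sups (g ^ n) = (n : ℤ) * Γ.zsup g := by
  intro n hn
  have ht := Γ.tsup_pow g n hn
  have hg' : (Γ.zsup g : ℝ) = Γ.tsup g := hg
  have hlow : ∀ h : G, (n : ℤ) * Γ.zsup g ≤ Γ.zsup (h⁻¹ * g ^ n * h) := by
    intro h
    have := Γ.tsup_le_conj (g ^ n) h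
    rw [ht, ← hg'] at this
    exact_mod_cast this
  have h1 := hlow 1
  simp only [inv_one, one_mul, mul_one] at h1
  have heq : Γ.zsup (g ^ n) = (n : ℤ) * Γ.zsup g := le_antisymm (Γ.zsup_pow g n) h1
  constructor
  · change (Γ.zsup (g ^ n) : ℝ) = Γ.tsup (g ^ n)
    rw [ht, heq, ← hg']; push_cast; rfl
  · obtain ⟨⟨h, hh⟩, hmin⟩ := Γ.sups_spec (g ^ n)
    apply le_antisymm
    · rw [← heq]
      exact hmin ⟨1, by simp⟩
    · rw [← hh]; exact hlow h
end
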